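/- Suppose that for every fundamental point m of c with m ≥ 138 there exists a least fundamental point m' > m, and that the largest index ρ ≤ m' with c(ρ) - c(ρ-1) > 1 satisfies ρ ≤ (5/4)(m + 3). Then for every integer n ≥ 2 there exists a pair of twin primes (p, p+2) with n ≤ p and p + 2 ≤ 3n. -/

import Mathlib

/-- The sequence `c` from the paper: `c 1 = 2` and, for `n ≥ 2`,
`c n = c (n-1) + gcd (n, c (n-1))` if `n` is even, and
`c n = c (n-1) + gcd (n-2, c (n-1))` if `n` is odd. -/
def c : ℕ → ℕ
  | 0 => 0
  | 1 => 2
  | n + 2 =>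
    c (n + 1) +
      (if (n + 2) % 2 = 0 then Nat.gcd (n + 2) (c (n + 1)) else Nat.gcd n (c (n + 1)))

/-- A fundamental point of `c`: an integer `n ≥ 2` with `c n = 2 n`. -/
def IsFundamentalC (n : ℕ) : Prop := 2 ≤ n ∧ c n = 2 * n

theorem c_add_two_of_even {n : ℕ} (hn : Even n) :
    c (n + 2) = c (n + 1) + Nat.gcd (n + 2) (c (n + 1)) := by
  have h : (n + 2) % 2 = 0 := by grind
  rw [c, if_pos h]

theorem c_add_two_of_odd {n : ℕ} (hn : Odd n) :
    c (n + 2) = c (n + 1) + Nat.gcd n (c (n + 1)) := by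
  have h : ¬(n + 2) % 2 = 0 := by grind
  rw [c, if_neg h]

theorem c_lt_c_succ (n : ℕ) : c n < c (n + 1) := by
  rcases n with - | n
  · simp [c]
  change c (n + 1) < c (n + 2)
  rcases Nat.even_or_odd n with h | h
  · have := Nat.gcd_pos_of_pos_left (c (n + 1)) (show 0 < n + 2 by omega)
    have := c_add_two_of_even h
    omega
  · have := Nat.gcd_pos_of_pos_left (c (n + 1)) h.pos
    have := c_add_two_of_odd h
    omega

theorem isFundamentalC_138 : IsFundamentalC 138 := by
  refine ⟨by norm_num, ?_⟩
  simp [c]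

theorem c_add_one_of_fundamental {m : ℕ} (hf : IsFundamentalC m) (h6 : 6 ∣ m) :
    c (m + 1) = 2 * m + 1 := by
  obtain ⟨h2, hc⟩ := hf
  obtain ⟨n, rfl⟩ : ∃ n, m = n + 1 := ⟨m - 1, by omega⟩
  have hodd : Odd n := by grind
  rw [c_add_two_of_odd hodd, hc]
  have h : Nat.gcd n (2 * (n + 1)) = 1 := by
    rw [show 2 * (n + 1) = 2 + n * 2 by ring, Nat.gcd_add_mul_left_right]
    exact hodd.coprime_two_right
  omega

theorem c_add_two_of_fundamental {m : ℕ} (hf : IsFundamentalC m) (h6 : 6 ∣ m) :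
    c (m + 2) = 2 * m + 2 := by
  have heven : Even m := by grind
  rw [c_add_two_of_even heven, c_add_one_of_fundamental hf h6]
  have h : Nat.gcd (m + 2) (2 * m + 1) = 1 := by
    have h3 : Nat.gcd (m + 2) (2 * m + 1) ∣ 3 := by
      have h := Nat.dvd_sub ((Nat.gcd_dvd_left (m + 2) (2 * m + 1)).mul_left 2)
        (Nat.gcd_dvd_right (m + 2) (2 * m + 1))
      rwa [show 2 * (m + 2) - (2 * m + 1) = 3 by omega] at h
    rcases (Nat.dvd_prime Nat.prime_three).mp h3 with h | h
    · exact h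
    · have := Nat.gcd_dvd_left (m + 2) (2 * m + 1)
      rw [h] at this
      omega
  omega

theorem c_add_three_of_fundamental {m : ℕ} (hf : IsFundamentalC m) (h6 : 6 ∣ m) :
    c (m + 3) = 3 * m + 3 := by
  have hodd : Odd (m + 1) := by grind
  rw [c_add_two_of_odd hodd, c_add_two_of_fundamental hf h6,
    show 2 * m + 2 = 2 * (m + 1) by ring, Nat.gcd_mul_left_right]
  ring

/-- The value `3 * n` is an upper barrier for `c n`. The defects `1` and `3` have to be excluded
as well, since the defect `3` would let the next increment be as large as its index. -/
theorem c_add_defect_eq {m : ℕ} (hf : IsFundamentalC m) (h6 : 6 ∣ m) {n : ℕ} (hn : m + 3 ≤ n) :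
    ∃ e, c n + e = 3 * n ∧ e ≠ 1 ∧ e ≠ 3 := by
  induction n, hn using Nat.le_induction with
  | base => exact ⟨6, by rw [c_add_three_of_fundamental hf h6]; ring, by norm_num, by norm_num⟩
  | succ n hn ih =>
    obtain ⟨e, he, h1, h3⟩ := ih
    obtain ⟨k, rfl⟩ : ∃ k, n = k + 1 := ⟨n - 1, by omega⟩
    change ∃ e, c (k + 2) + e = 3 * (k + 2) ∧ e ≠ 1 ∧ e ≠ 3
    rcases Nat.even_or_odd k with hk | hk
    · have hc := c_add_two_of_even hk
      have hd : Nat.gcd (k + 2) (c (k + 1)) ∣ e + 3 := by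
        have h := Nat.dvd_sub ((Nat.gcd_dvd_left (k + 2) (c (k + 1))).mul_left 3)
          (Nat.gcd_dvd_right (k + 2) (c (k + 1)))
        rwa [show 3 * (k + 2) - c (k + 1) = e + 3 by omega] at h
      generalize Nat.gcd (k + 2) (c (k + 1)) = g at hc hd
      have hle := Nat.le_of_dvd (by omega) hd
      refine ⟨e + 3 - g, by omega, ?_, ?_⟩
      · intro h
        obtain rfl : g = e + 2 := by omega
        have := (Nat.dvd_add_right (dvd_refl (e + 2))).mp (show e + 2 ∣ e + 2 + 1 from hd)
        have := Nat.le_of_dvd one_pos this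
        omega
      · intro h
        obtain rfl : g = e := by omega
        have := (Nat.dvd_add_right (dvd_refl g)).mp hd
        rcases (Nat.dvd_prime Nat.prime_three).mp this with h | h <;> omega
    · have hc := c_add_two_of_odd hk
      have hd : (Nat.gcd k (c (k + 1)) : ℤ) ∣ e - 3 := by
        have h := dvd_sub
          ((Int.natCast_dvd_natCast.mpr (Nat.gcd_dvd_left k (c (k + 1)))).mul_left 3)
          (Int.natCast_dvd_natCast.mpr (Nat.gcd_dvd_right k (c (k + 1))))
        rwa [show 3 * (k : ℤ) - (c (k + 1) : ℤ) = e - 3 by omega] at h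
      generalize Nat.gcd k (c (k + 1)) = g at hc hd
      have hg : (g = 1 ∨ g = 3) ∧ e = 0 ∨ g = 1 ∧ e = 2 ∨ g + 3 ≤ e := by
        obtain rfl | rfl | h4 : e = 0 ∨ e = 2 ∨ 4 ≤ e := by omega
        · have h : g ∣ 3 := by exact_mod_cast (dvd_neg.mp (by simpa using hd) : (g : ℤ) ∣ 3)
          rcases (Nat.dvd_prime Nat.prime_three).mp h with h | h <;> omega
        · have h : g ∣ 1 := by exact_mod_cast (dvd_neg.mp (by simpa using hd) : (g : ℤ) ∣ 1)
          exact .inr (.inl ⟨Nat.dvd_one.mp h, rfl⟩)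
        · have := Int.le_of_dvd (by omega) hd
          omega
      exact ⟨e + 3 - g, by omega, by omega, by omega⟩

theorem add_le_c_of_fundamental {m : ℕ} (hf : IsFundamentalC m) (h6 : 6 ∣ m) {n : ℕ}
    (hn : m + 3 ≤ n) : 2 * m + n ≤ c n := by
  induction n, hn using Nat.le_induction with
  | base => rw [c_add_three_of_fundamental hf h6]; omega
  | succ n hn ih =>
    have := c_lt_c_succ n
    omega

section TrivialIncrements

variable {ρ M q : ℕ}

theorem not_dvd_sub_one_of_trivial_increments (hc : ∀ k, ρ ≤ k → k ≤ M → c k = M + k)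
    (hq : 2 ≤ q) (hlen : ρ + 2 * q ≤ M) : ¬q ∣ M - 1 := by
  intro hd
  have hdiv := Nat.div_add_mod M (2 * q)
  have hmod := Nat.mod_lt M (show 0 < 2 * q by omega)
  generalize M / (2 * q) = t at hdiv
  have hqk : q ∣ 2 * q * t := Dvd.intro_left (2 * t) (by ring)
  have heven : Even (2 * q * t) := ⟨q * t, by ring⟩
  generalize 2 * q * t = k at *
  have hk2 : 2 ≤ k := by grind
  obtain ⟨n, rfl⟩ : ∃ n, k = n + 2 := ⟨k - 2, by omega⟩
  have h₁ := hc (n + 1) (by omega) (by omega)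
  have h₂ := hc (n + 2) (by omega) (by omega)
  have h₃ := c_add_two_of_even (n := n) (by grind)
  have hqc : q ∣ c (n + 1) := by
    rw [h₁, show M + (n + 1) = M - 1 + (n + 2) by omega]
    exact hd.add hqk
  have h₄ := Nat.dvd_gcd hqk hqc
  rw [show Nat.gcd (n + 2) (c (n + 1)) = 1 by omega] at h₄
  have := Nat.le_of_dvd one_pos h₄
  omega

theorem not_dvd_add_one_of_trivial_increments (hc : ∀ k, ρ ≤ k → k ≤ M → c k = M + k)
    (hq : 2 ≤ q) (hodd : Odd q) (hlen : ρ + 2 * q ≤ M) (hq' : q + 2 ≤ M) : ¬q ∣ M + 1 := by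
  intro hd
  have hdiv := Nat.div_add_mod (M - 2 - q) (2 * q)
  have hmod := Nat.mod_lt (M - 2 - q) (show 0 < 2 * q by omega)
  generalize (M - 2 - q) / (2 * q) = t at hdiv
  have hqk : q ∣ 2 * q * t + q := Dvd.intro_left (2 * t + 1) (by ring)
  have hn : Odd (2 * q * t + q) := Even.add_odd ⟨q * t, by ring⟩ hodd
  generalize hk : 2 * q * t + q = n at *
  have h₁ := hc (n + 1) (by omega) (by omega)
  have h₂ := hc (n + 2) (by omega) (by omega)
  have h₃ := c_add_two_of_odd hn
  have hqc : q ∣ c (n + 1) := by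
    rw [h₁, show M + (n + 1) = M + 1 + n by omega]
    exact hd.add hqk
  have h₄ := Nat.dvd_gcd hqk hqc
  rw [show Nat.gcd n (c (n + 1)) = 1 by omega] at h₄
  have := Nat.le_of_dvd one_pos h₄
  omega

theorem twin_primes_of_trivial_increments (hc : ∀ k, ρ ≤ k → k ≤ M → c k = M + k)
    (hM : 276 ≤ M) (hρ : 8 * ρ ≤ 5 * M + 30) : Nat.Prime (M - 1) ∧ Nat.Prime (M + 1) := by
  have hlen : ∀ q : ℕ, q ^ 2 ≤ M + 1 → ρ + 2 * q ≤ M := by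
    intro q hq
    by_contra! h
    have h₁ : 3 * M < 16 * q + 30 := by omega
    nlinarith
  have hp : Nat.Prime (M - 1) := by
    by_contra hp
    have hsq := Nat.minFac_sq_le_self (by omega) hp
    exact not_dvd_sub_one_of_trivial_increments hc
      (Nat.minFac_prime (by omega)).two_le (hlen _ (by omega)) (Nat.minFac_dvd _)
  refine ⟨hp, ?_⟩
  by_contra hp'
  have hsq := Nat.minFac_sq_le_self (by omega) hp'
  have hq := Nat.minFac_prime (show M + 1 ≠ 1 by omega)
  have hodd : Odd (M + 1) := by
    have := hp.odd_of_ne_two (by omega)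
    grind
  have hle := hlen _ hsq
  exact not_dvd_add_one_of_trivial_increments hc hq.two_le (hodd.of_dvd_nat (Nat.minFac_dvd _))
    hle (by have := hq.two_le; omega) (Nat.minFac_dvd _)

end TrivialIncrements

theorem six_dvd_of_twin_primes {M : ℕ} (hM : 5 ≤ M) (hp : Nat.Prime (M - 1))
    (hq : Nat.Prime (M + 1)) : 6 ∣ M := by
  have h2 : ¬2 ∣ M - 1 := fun h => by
    have := (Nat.prime_dvd_prime_iff_eq Nat.prime_two hp).mp h
    omega
  have h3 : ¬3 ∣ M - 1 := fun h => by
    have := (Nat.prime_dvd_prime_iff_eq Nat.prime_three hp).mp h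
    omega
  have h3' : ¬3 ∣ M + 1 := fun h => by
    have := (Nat.prime_dvd_prime_iff_eq Nat.prime_three hq).mp h
    omega
  have h6 : M % 6 = 0 ∨ M % 6 = 1 ∨ M % 6 = 2 ∨ M % 6 = 3 ∨ M % 6 = 4 ∨ M % 6 = 5 := by omega
  rcases h6 with h | h | h | h | h | h <;> omega

/-- A later fundamental point `m'` of `c` whose last preceding nontrivial increment is not too
far from `m` lies between twin primes. -/
theorem twin_primes_at_next_fundamental {m m' : ℕ} (hm : 138 ≤ m) (hf : IsFundamentalC m)
    (h6 : 6 ∣ m) (hf' : IsFundamentalC m') (hlt : m < m')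
    (hρ : ∀ ρ : ℕ, ρ ≤ m' → 1 < c ρ - c (ρ - 1) →
      (∀ σ : ℕ, σ ≤ m' → 1 < c σ - c (σ - 1) → σ ≤ ρ) → 4 * ρ ≤ 5 * (m + 3)) :
    6 ∣ m' ∧ Nat.Prime (m' - 1) ∧ Nat.Prime (m' + 1) ∧ 2 * m' ≤ 5 * m + 15 := by
  have hc₁ := c_add_one_of_fundamental hf h6
  have hc₂ := c_add_two_of_fundamental hf h6
  have hc₃ := c_add_three_of_fundamental hf h6
  have hm' : m + 3 ≤ m' := by
    have := hf'.2
    by_contra! h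
    obtain rfl | rfl : m' = m + 1 ∨ m' = m + 2 := by omega
    all_goals omega
  have hjump : 1 < c (m + 3) - c (m + 3 - 1) := by
    rw [show m + 3 - 1 = m + 2 by omega]
    omega
  set ρ := Nat.findGreatest (fun σ => 1 < c σ - c (σ - 1)) m'
  have hle : ρ ≤ m' := Nat.findGreatest_le m'
  have hge : m + 3 ≤ ρ := Nat.le_findGreatest hm' hjump
  have hbound := hρ ρ hle (Nat.findGreatest_spec (P := fun σ => 1 < c σ - c (σ - 1)) hm' hjump)
    fun σ hσ h => Nat.le_findGreatest hσ h
  have hc : ∀ k, ρ ≤ k → k ≤ m' → c k = m' + k := by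
    intro k hk hkm
    induction hkm using Nat.decreasingInduction with
    | self => rw [hf'.2]; ring
    | of_succ k hkm ih =>
      have h₁ := ih (by omega)
      have h₂ := Nat.findGreatest_is_greatest (P := fun σ => 1 < c σ - c (σ - 1))
        (show ρ < k + 1 by omega) (by omega)
      have h₃ := c_lt_c_succ k
      simp only [Nat.add_sub_cancel] at h₂
      omega
  have hcρ := hc ρ le_rfl hle
  obtain ⟨e, he, -, -⟩ := c_add_defect_eq hf h6 hge
  have hlow := add_le_c_of_fundamental hf h6 hge
  obtain ⟨hp, hq⟩ := twin_primes_of_trivial_increments hc (by omega) (by omega)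
  exact ⟨six_dvd_of_twin_primes (by omega) hp hq, hp, hq, by omega⟩

/-- If every fundamental point `m ≥ 138` of `c` is followed by a least fundamental point
`m'`, and the largest index `ρ ≤ m'` of a nontrivial increment satisfies
`ρ ≤ (5/4) (m + 3)`, then between every `n ≥ 2` and `3 n` there is a pair of twin primes. -/
theorem twin_primes_between_n_and_three_n
    (hyp : ∀ m : ℕ, 138 ≤ m → IsFundamentalC m →
      ∃ m' : ℕ, IsFundamentalC m' ∧ m < m' ∧
        (∀ k : ℕ, IsFundamentalC k → m < k → m' ≤ k) ∧
        ∀ ρ : ℕ, ρ ≤ m' → 1 < c ρ - c (ρ - 1) →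
          (∀ σ : ℕ, σ ≤ m' → 1 < c σ - c (σ - 1) → σ ≤ ρ) →
          (ρ : ℝ) ≤ (5 / 4 : ℝ) * ((m : ℝ) + 3)) :
    ∀ n : ℕ, 2 ≤ n →
      ∃ p : ℕ, Nat.Prime p ∧ Nat.Prime (p + 2) ∧ n ≤ p ∧ p + 2 ≤ 3 * n := by
  have key : ∀ n : ℕ, 138 ≤ n → ∃ m m' : ℕ, m ≤ n ∧ n < m' ∧ 138 ≤ m' ∧ IsFundamentalC m' ∧
      6 ∣ m' ∧ Nat.Prime (m' - 1) ∧ Nat.Prime (m' + 1) ∧ 2 * m' ≤ 5 * m + 15 := by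
    have step : ∀ m : ℕ, 138 ≤ m → IsFundamentalC m → 6 ∣ m → ∃ m' : ℕ, m < m' ∧
        IsFundamentalC m' ∧ 6 ∣ m' ∧ Nat.Prime (m' - 1) ∧ Nat.Prime (m' + 1) ∧
        2 * m' ≤ 5 * m + 15 := by
      intro m hm hf h6
      obtain ⟨m', hf', hlt, -, hρ⟩ := hyp m hm hf
      refine ⟨m', hlt, hf', twin_primes_at_next_fundamental hm hf h6 hf' hlt ?_⟩
      intro ρ h₁ h₂ h₃
      have h := hρ ρ h₁ h₂ h₃
      have h' : (4 * ρ : ℝ) ≤ 5 * (m + 3) := by linarith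
      exact_mod_cast h'
    intro n hn
    induction n, hn using Nat.le_induction with
    | base =>
      obtain ⟨m', h₁, h₂, h₃, h₄⟩ := step 138 le_rfl isFundamentalC_138 (by norm_num)
      exact ⟨138, m', le_rfl, h₁, h₁.le, h₂, h₃, h₄⟩
    | succ n hn ih =>
      obtain ⟨m, m', hmn, hnm', hm', hf', h6, hp⟩ := ih
      by_cases h : n + 1 < m'
      · exact ⟨m, m', by omega, h, hm', hf', h6, hp⟩
      · obtain ⟨m'', h₁, h₂, h₃, h₄⟩ := step m' hm' hf' h6
        exact ⟨m', m'', by omega, by omega, by omega, h₂, h₃, h₄⟩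
  intro n hn
  by_cases hn' : 138 ≤ n
  · obtain ⟨m, m', hmn, hnm', hm', -, -, hp, hq, hle⟩ := key n hn'
    refine ⟨m' - 1, hp, ?_, by omega, by omega⟩
    rwa [show m' - 1 + 2 = m' + 1 by omega]
  · obtain h | h | h | h | h : n ≤ 2 ∨ 3 ≤ n ∧ n ≤ 5 ∨ 6 ≤ n ∧ n ≤ 11 ∨ 12 ≤ n ∧ n ≤ 29 ∨
        30 ≤ n := by omega
    · exact ⟨3, by norm_num, by norm_num, by omega, by omega⟩
    · exact ⟨5, by norm_num, by norm_num, by omega, by omega⟩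
    · exact ⟨11, by norm_num, by norm_num, by omega, by omega⟩
    · exact ⟨29, by norm_num, by norm_num, by omega, by omega⟩
    · by_cases h' : n ≤ 59
      · exact ⟨59, by norm_num, by norm_num, by omega, by omega⟩
      · exact ⟨137, by norm_num, by norm_num, by omega, by omega⟩
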